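/- arXiv:1802.05399 — 2 statements merged into one kernel-verified Lean document; each statement's English description precedes it below -/
import Mathlib

section
/- Let T ≥ 1 be an integer, let a_1 < a_2 < … < a_T be a strictly increasing sequence of integers, and let b_1 ≥ b_2 ≥ … ≥ b_T be a non-increasing sequence of real numbers. Then the total squared loss satisfies Σ_{i=1}^T (a_i − b_i)² ≥ (T³ − T)/12. -/
open Finset in
theorem sum_sum_sub_sq {ι : Type*} [Fintype ι] (c : ι → ℝ) :
    ∑ i, ∑ j, (c i - c j) ^ 2 = 2 * Fintype.card ι * ∑ i, c i ^ 2 - 2 * (∑ i, c i) ^ 2 := by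
  simp only [sub_sq, sum_add_distrib, sum_sub_distrib, ← mul_sum, ← sum_mul, sum_const,
    card_univ, nsmul_eq_mul]
  ring

theorem Fin.sum_cast_real (n : ℕ) : ∑ i : Fin n, (i : ℝ) = n * (n - 1) / 2 := by
  induction n with
  | zero => simp
  | succ n ih =>
    simp only [Fin.sum_univ_castSucc, Fin.val_castSucc, Fin.val_last, ih]
    push_cast
    ring

theorem Fin.sum_cast_real_sq (n : ℕ) :
    ∑ i : Fin n, (i : ℝ) ^ 2 = n * (n - 1) * (2 * n - 1) / 6 := by
  induction n with
  | zero => simp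
  | succ n ih =>
    simp only [Fin.sum_univ_castSucc, Fin.val_castSucc, Fin.val_last, ih]
    push_cast
    ring

theorem StrictMono.fin_sub_le_int_sub {n : ℕ} {a : Fin n → ℤ} (ha : StrictMono a)
    {i j : Fin n} (hij : i ≤ j) : (j : ℤ) - i ≤ a j - a i := by
  have hcard : (Finset.Ioc i j).card ≤ (Finset.Ioc (a i) (a j)).card :=
    Finset.card_le_card_of_injOn a
      (fun k hk => by
        simp only [Finset.coe_Ioc, Set.mem_Ioc] at hk ⊢
        exact ⟨ha hk.1, ha.monotone hk.2⟩)
      ha.injective.injOn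
  have hval : (i : ℕ) ≤ j := hij
  have haij : a i ≤ a j := ha.monotone hij
  rw [Fin.card_Ioc, Int.card_Ioc] at hcard
  omega

/-- For any integer `T ≥ 1`, any strictly increasing sequence of
integers `a : Fin T → ℤ` and any non-increasing sequence of reals `b : Fin T → ℝ`,
the total squared loss satisfies `∑ i, (a i - b i)² ≥ (T³ - T)/12`. -/
theorem squared_loss_lower_bound (T : ℕ) (hT : 1 ≤ T)
    (a : Fin T → ℤ) (ha : StrictMono a)
    (b : Fin T → ℝ) (hb : Antitone b) :
    ((T : ℝ) ^ 3 - T) / 12 ≤ ∑ i, ((a i : ℝ) - b i) ^ 2 := by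
  have sub_le : ∀ {i j : Fin T}, i ≤ j →
      ((i : ℝ) - j) ^ 2 ≤ (((a i : ℝ) - b i) - (a j - b j)) ^ 2 := by
    intro i j hij
    have hval : (i : ℝ) ≤ j := by exact_mod_cast hij
    have hab : (j : ℝ) - i ≤ a j - a i := by exact_mod_cast ha.fin_sub_le_int_sub hij
    rw [sub_sq_comm, sub_sq_comm (_ - _)]
    exact pow_le_pow_left₀ (by linarith) (by linarith [hb hij]) 2
  have hpairs : ∑ i : Fin T, ∑ j : Fin T, ((i : ℝ) - j) ^ 2 ≤
      ∑ i, ∑ j, (((a i : ℝ) - b i) - (a j - b j)) ^ 2 := by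
    refine Finset.sum_le_sum fun i _ => Finset.sum_le_sum fun j _ => ?_
    rcases le_total i j with hij | hji
    · exact sub_le hij
    · rw [sub_sq_comm, sub_sq_comm (_ - _)]
      exact sub_le hji
  rw [sum_sum_sub_sq (fun i : Fin T => (i : ℝ)), sum_sum_sub_sq (fun i => (a i : ℝ) - b i),
    Fin.sum_cast_real, Fin.sum_cast_real_sq, Fintype.card_fin] at hpairs
  have hTpos : (0 : ℝ) < T := by exact_mod_cast hT
  refine le_of_mul_le_mul_left ?_ hTpos
  linarith [sq_nonneg (∑ i, ((a i : ℝ) - b i))]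
end

section
/- In the caching model with phases and clean elements defined below, the expected total number of cache misses incurred by the randomized Marker algorithm on σ is at most Σ_r ℓ_r · H_k = L · H_k, where H_k = 1 + 1/2 + … + 1/k is the k-th harmonic number. -/
open Finset

variable {Z : Type*}

section Caching
variable [DecidableEq Z]

/-- A feasible schedule for cache size `k`, initial cache `S0` and request
sequence `σ` (of length `n`): caches have size at most `k`, contain each request
when it arrives, and change only by inserting the requested element. -/
def IsSchedule (k n : ℕ) (S0 : Finset Z) (σ : ℕ → Z) (C : ℕ → Finset Z) : Prop :=
  C 0 = S0 ∧ ∀ i < n, (C (i + 1)).card ≤ k ∧ σ i ∈ C (i + 1) ∧ C (i + 1) ⊆ C i ∪ {σ i}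

/-- Number of cache misses of the schedule `C` on requests with indices in `[s, e)`. -/
def missesIn (σ : ℕ → Z) (C : ℕ → Finset Z) (s e : ℕ) : ℕ :=
  ((Finset.Ico s e).filter (fun i => σ i ∉ C i)).card

/-- Total number of cache misses of the schedule `C` on the request sequence. -/
def schedCost (n : ℕ) (σ : ℕ → Z) (C : ℕ → Finset Z) : ℕ := missesIn σ C 0 n

/-- The offline optimum: minimum number of misses over all feasible schedules. -/
noncomputable def OPT (k n : ℕ) (S0 : Finset Z) (σ : ℕ → Z) : ℕ :=
  sInf {c | ∃ C : ℕ → Finset Z, IsSchedule k n S0 σ C ∧ schedCost n σ C = c}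

/-- End of the greedy phase starting at position `s`: the largest `e ≤ n` such that
the requests with indices in `[s, e)` contain at most `k` distinct elements. -/
noncomputable def phaseEndPos (k n : ℕ) (σ : ℕ → Z) (s : ℕ) : ℕ :=
  sSup {e | e ≤ n ∧ ((Finset.Ico s e).image σ).card ≤ k}

/-- Start position of the `r`-th greedy phase (`0`-indexed). -/
noncomputable def phaseStart (k n : ℕ) (σ : ℕ → Z) : ℕ → ℕ
  | 0 => 0
  | r + 1 => phaseEndPos k n σ (phaseStart k n σ r)

/-- The set of distinct elements requested during phase `r`. -/
noncomputable def phaseElems (k n : ℕ) (σ : ℕ → Z) (r : ℕ) : Finset Z :=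
  (Finset.Ico (phaseStart k n σ r) (phaseStart k n σ (r + 1))).image σ

/-- Clean elements of phase `r`: requested in phase `r` but not in phase `r - 1`
(for the first phase: not in the initial cache `S0`). -/
noncomputable def cleanSet (k n : ℕ) (σ : ℕ → Z) (S0 : Finset Z) : ℕ → Finset Z
  | 0 => phaseElems k n σ 0 \ S0
  | r + 1 => phaseElems k n σ (r + 1) \ phaseElems k n σ r

/-- `L`, the total number of clean elements over all phases. -/
noncomputable def totalClean (k n : ℕ) (σ : ℕ → Z) (S0 : Finset Z) : ℕ :=
  ∑ r ∈ Finset.range n, (cleanSet k n σ S0 r).card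

end Caching

/-- The `k`-th harmonic number `H_k = 1 + 1/2 + … + 1/k`. -/
noncomputable def harmonic' (k : ℕ) : ℝ := ∑ i ∈ Finset.range k, (1 : ℝ) / (i + 1)

/-- Expected number of cache misses of the randomized Marker algorithm on the
remaining request list, from current cache `C` and current marked set `M`.
A requested cached element is marked.  On a miss (when the cache is full and all
its elements are marked, the marks are first cleared, starting a new phase), a
uniformly random unmarked cached element is evicted and the requested element is
inserted and marked. -/
noncomputable def markerExp [DecidableEq Z] (k : ℕ) :
    List Z → Finset Z → Finset Z → ℝ
  | [], _, _ => 0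
  | z :: rest, C, M =>
    if z ∈ C then markerExp k rest C (insert z M)
    else if (C.card < k) then 1 + markerExp k rest (insert z C) (insert z M)
    else
      -- cache miss with a full cache; clear marks if all elements are marked
      let M' := if M = C then (∅ : Finset Z) else M
      let U := C \ M'
      1 + (∑ e ∈ U, markerExp k rest (insert z (C.erase e)) (insert z (M'.erase e))) / U.card
  termination_by l => l.length

section MarkerAnalysis
variable [DecidableEq Z]

/-- Closed form of the expected number of misses of Marker, averaged over the random cache
content: `S` is the cache at the start of the current phase and `M` the current marked set. -/
noncomputable def averagedMisses (k : ℕ) : List Z → Finset Z → Finset Z → ℝ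
  | [], _, _ => 0
  | z :: l, M, S =>
    if z ∈ M then averagedMisses k l M S
    else if M.card = k then 1 + averagedMisses k l {z} M
    else if z ∈ S then
      ((M \ S).card : ℝ) / (S \ M).card + averagedMisses k l (insert z M) S
    else 1 + averagedMisses k l (insert z M) S

lemma sum_powersetCard_sum_sdiff_insert (A : Finset Z) (c : ℕ) (f : Finset Z → ℝ) :
    ∑ D ∈ A.powersetCard c, ∑ e ∈ A \ D, f (insert e D)
      = (c + 1) * ∑ D ∈ A.powersetCard (c + 1), f D := by
  have h : ∑ D ∈ A.powersetCard (c + 1), ∑ _e ∈ D, f D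
      = (c + 1) * ∑ D ∈ A.powersetCard (c + 1), f D := by
    rw [Finset.mul_sum]
    refine Finset.sum_congr rfl fun D hD => ?_
    rw [Finset.sum_const, (Finset.mem_powersetCard.1 hD).2, nsmul_eq_mul]
    push_cast
    ring
  rw [← h, Finset.sum_sigma', Finset.sum_sigma']
  refine Finset.sum_bij' (fun x _ => ⟨insert x.2 x.1, x.2⟩) (fun x _ => ⟨x.1.erase x.2, x.2⟩)
    ?_ ?_ ?_ ?_ ?_
  · rintro ⟨D, e⟩ h
    simp only [Finset.mem_sigma, Finset.mem_powersetCard, Finset.mem_sdiff] at h ⊢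
    obtain ⟨⟨hD, hc⟩, he, heD⟩ := h
    refine ⟨⟨Finset.insert_subset he hD, ?_⟩, Finset.mem_insert_self _ _⟩
    rw [Finset.card_insert_of_notMem heD, hc]
  · rintro ⟨D, e⟩ h
    simp only [Finset.mem_sigma, Finset.mem_powersetCard, Finset.mem_sdiff] at h ⊢
    obtain ⟨⟨hD, hc⟩, he⟩ := h
    refine ⟨⟨(Finset.erase_subset _ _).trans hD, ?_⟩, hD he, Finset.notMem_erase _ _⟩
    rw [Finset.card_erase_of_mem he, hc, Nat.add_sub_cancel]
  · rintro ⟨D, e⟩ h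
    simp only [Finset.mem_sigma, Finset.mem_sdiff] at h
    simp [Finset.erase_insert h.2.2]
  · rintro ⟨D, e⟩ h
    simp only [Finset.mem_sigma] at h
    simp [Finset.insert_erase h.2]
  · rintro ⟨D, e⟩ _
    rfl

lemma card_union_sdiff_of_mem_powersetCard {M S D : Finset Z}
    (hD : D ∈ (S \ M).powersetCard (M \ S).card) : ((M ∪ S) \ D).card = S.card := by
  obtain ⟨hD, hc⟩ := Finset.mem_powersetCard.1 hD
  have h1 : D ⊆ M ∪ S := fun x hx => Finset.mem_union_right _ (Finset.mem_sdiff.1 (hD hx)).1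
  have h2 := Finset.card_sdiff_add_card M S
  rw [Finset.card_sdiff_of_subset h1]
  omega

/-- A miss in a full cache with some unmarked element. -/
lemma markerExp_cons_of_notMem {k : ℕ} {z : Z} {l : List Z} {C M : Finset Z} (hz : z ∉ C)
    (hC : C.card = k) (hM : M.card < k) :
    markerExp k (z :: l) C M = 1 + (∑ e ∈ C \ M,
      markerExp k l (insert z (C.erase e)) (insert z M)) / (C \ M).card := by
  have hne : M ≠ C := by rintro rfl; omega
  rw [markerExp, if_neg hz, if_neg (by omega)]
  simp only [if_neg hne]
  congr 2
  refine Finset.sum_congr rfl fun e he => ?_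
  rw [Finset.erase_eq_of_notMem (Finset.mem_sdiff.1 he).2]

/-- `averagedMisses` is the average of `markerExp` over the possible cache contents. -/
def IsAverage (k : ℕ) (l : List Z) : Prop :=
  ∀ M S : Finset Z, S.card = k → M.card ≤ k →
    ∑ D ∈ (S \ M).powersetCard (M \ S).card, markerExp k l ((M ∪ S) \ D) M
      = ((S \ M).card.choose (M \ S).card : ℝ) * averagedMisses k l M S

lemma card_sdiff_lt_card_sdiff {k : ℕ} {M S : Finset Z} (hS : S.card = k) (hM : M.card < k) :
    (M \ S).card < (S \ M).card := by
  have h1 := Finset.card_sdiff_add_card_inter M S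
  have h2 := Finset.card_sdiff_add_card_inter S M
  rw [Finset.inter_comm] at h2
  omega

lemma IsAverage.cons_clean {k : ℕ} {l : List Z} (hl : IsAverage k l) {z : Z} {M S : Finset Z}
    (hS : S.card = k) (hM : M.card < k) (hzM : z ∉ M) (hzS : z ∉ S) :
    ∑ D ∈ (S \ M).powersetCard (M \ S).card, markerExp k (z :: l) ((M ∪ S) \ D) M
      = ((S \ M).card.choose (M \ S).card : ℝ) * (1 + averagedMisses k l (insert z M) S) := by
  have hlt := card_sdiff_lt_card_sdiff hS hM
  have key := hl (insert z M) S hS (by rw [Finset.card_insert_of_notMem hzM]; omega)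
  have hA : S \ insert z M = S \ M := by
    rw [Finset.sdiff_insert, Finset.erase_eq_of_notMem (fun h => hzS (Finset.mem_sdiff.1 h).1)]
  have hc : (insert z M \ S).card = (M \ S).card + 1 := by
    rw [Finset.insert_sdiff_of_notMem _ hzS,
      Finset.card_insert_of_notMem (fun h => hzM (Finset.mem_sdiff.1 h).1)]
  rw [hA, hc] at key
  have step : ∀ D ∈ (S \ M).powersetCard (M \ S).card,
      markerExp k (z :: l) ((M ∪ S) \ D) M = 1 + (∑ e ∈ (S \ M) \ D,
        markerExp k l ((insert z M ∪ S) \ insert e D) (insert z M)) /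
          ((S \ M).card - (M \ S).card : ℝ) := by
    intro D hD
    have hcard := card_union_sdiff_of_mem_powersetCard hD
    obtain ⟨hDs, hDc⟩ := Finset.mem_powersetCard.1 hD
    have hU : ((M ∪ S) \ D) \ M = (S \ M) \ D := by grind
    rw [markerExp_cons_of_notMem (by grind) (hcard.trans hS) hM, hU,
      Finset.card_sdiff_of_subset hDs, hDc, Nat.cast_sub hlt.le]
    congr 2
    refine Finset.sum_congr rfl fun e he => ?_
    congr 1
    ext x
    have := @hDs x
    grind
  rw [Finset.sum_congr rfl step, Finset.sum_add_distrib, ← Finset.sum_div,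
    sum_powersetCard_sum_sdiff_insert (S \ M) _
      (fun D => markerExp k l ((insert z M ∪ S) \ D) (insert z M)), key]
  have hch : ((S \ M).card.choose ((M \ S).card + 1) : ℝ) * ((M \ S).card + 1)
      = ((S \ M).card.choose (M \ S).card : ℝ) * ((S \ M).card - (M \ S).card) := by
    rw [← Nat.cast_sub hlt.le]
    exact_mod_cast Nat.choose_succ_right_eq _ _
  have hpos : ((S \ M).card - (M \ S).card : ℝ) ≠ 0 :=
    (sub_pos.2 (by exact_mod_cast hlt)).ne'
  simp only [Finset.sum_const, Finset.card_powersetCard, nsmul_eq_mul, mul_one]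
  rw [mul_add, mul_one, ← mul_assoc, mul_comm _ (Nat.cast _ : ℝ), hch]
  field_simp

lemma IsAverage.cons_stale {k : ℕ} {l : List Z} (hl : IsAverage k l) {z : Z} {M S : Finset Z}
    (hS : S.card = k) (hM : M.card < k) (hzM : z ∉ M) (hzS : z ∈ S) :
    ∑ D ∈ (S \ M).powersetCard (M \ S).card, markerExp k (z :: l) ((M ∪ S) \ D) M
      = ((S \ M).card.choose (M \ S).card : ℝ) *
        (((M \ S).card : ℝ) / (S \ M).card + averagedMisses k l (insert z M) S) := by
  have hlt := card_sdiff_lt_card_sdiff hS hM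
  have key := hl (insert z M) S hS (by rw [Finset.card_insert_of_notMem hzM]; omega)
  have hu : insert z M ∪ S = M ∪ S := by grind
  have hc : insert z M \ S = M \ S := Finset.insert_sdiff_of_mem _ hzS
  have hzA : z ∉ S \ insert z M := by simp
  have hA : S \ M = insert z (S \ insert z M) := by grind
  have hN : (S \ M).card = (S \ insert z M).card + 1 := by
    rw [hA, Finset.card_insert_of_notMem hzA]
  have hfull : ∀ D ∈ (S \ M).powersetCard (M \ S).card, ((M ∪ S) \ D).card = k :=
    fun D hD => (card_union_sdiff_of_mem_powersetCard hD).trans hS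
  rw [hc, hu] at key
  rw [hN] at hlt ⊢
  rw [hA] at hfull ⊢
  generalize hcc : (M \ S).card = c at *
  have hit : ∀ D ∈ (S \ insert z M).powersetCard c,
      markerExp k (z :: l) ((M ∪ S) \ D) M = markerExp k l ((M ∪ S) \ D) (insert z M) := by
    intro D hD
    have hDs := (Finset.mem_powersetCard.1 hD).1
    rw [markerExp, if_pos]
    have := @hDs z
    grind
  cases c with
  | zero =>
    simp only [Finset.powersetCard_zero, Finset.sum_singleton] at hit key ⊢
    rw [hit ∅ (by simp), key]
    simp
  | succ c =>
    have miss : ∀ E ∈ (S \ insert z M).powersetCard c,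
        markerExp k (z :: l) ((M ∪ S) \ insert z E) M =
          1 + (∑ e ∈ (S \ insert z M) \ E,
            markerExp k l ((M ∪ S) \ insert e E) (insert z M)) /
              ((S \ insert z M).card - c : ℝ) := by
      intro E hE
      obtain ⟨hEs, hEc⟩ := Finset.mem_powersetCard.1 hE
      have hzE : z ∉ E := fun h => hzA (hEs h)
      have hU : ((M ∪ S) \ insert z E) \ M = (S \ insert z M) \ E := by grind
      rw [markerExp_cons_of_notMem (by simp) (hfull _ ?_) hM, hU,
        Finset.card_sdiff_of_subset hEs, hEc, Nat.cast_sub (by omega)]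
      · congr 2
        refine Finset.sum_congr rfl fun e he => ?_
        congr 1
        ext x
        have := @hEs x
        grind
      · rw [Finset.mem_powersetCard, Finset.card_insert_of_notMem hzE, hEc]
        exact ⟨Finset.insert_subset_insert _ hEs, rfl⟩
    have hdisj : Disjoint ((S \ insert z M).powersetCard (c + 1))
        (((S \ insert z M).powersetCard c).image (insert z)) := by
      rw [Finset.disjoint_left]
      intro D hD hD'
      obtain ⟨E, -, rfl⟩ := Finset.mem_image.1 hD'
      exact hzA ((Finset.mem_powersetCard.1 hD).1 (Finset.mem_insert_self _ _))
    have hinj : Set.InjOn (insert z) ((S \ insert z M).powersetCard c : Set (Finset Z)) := by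
      intro E hE E' hE' h
      have h1 : z ∉ E := fun h => hzA ((Finset.mem_powersetCard.1 hE).1 h)
      have h2 : z ∉ E' := fun h => hzA ((Finset.mem_powersetCard.1 hE').1 h)
      rw [← Finset.erase_insert h1, ← Finset.erase_insert h2, h]
    rw [Finset.powersetCard_succ_insert hzA, Finset.sum_union hdisj, Finset.sum_image hinj,
      Finset.sum_congr rfl hit, Finset.sum_congr rfl miss, key, Finset.sum_add_distrib,
      ← Finset.sum_div, sum_powersetCard_sum_sdiff_insert (S \ insert z M) c
        (fun D => markerExp k l ((M ∪ S) \ D) (insert z M)), key]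
    simp only [Finset.sum_const, Finset.card_powersetCard, nsmul_eq_mul, mul_one]
    generalize (S \ insert z M).card = N at *
    have hch : (N.choose (c + 1) : ℝ) * (c + 1) = (N.choose c : ℝ) * (N - c) := by
      rw [← Nat.cast_sub (by omega)]
      exact_mod_cast Nat.choose_succ_right_eq _ _
    have hch2 : ((N : ℝ) + 1) * (N.choose c : ℝ) = ((N + 1).choose (c + 1) : ℝ) * (c + 1) := by
      exact_mod_cast Nat.add_one_mul_choose_eq N c
    have hpos : (N - c : ℝ) ≠ 0 := (sub_pos.2 (by exact_mod_cast (by omega : c < N))).ne'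
    have hpos2 : (N + 1 : ℝ) ≠ 0 := by positivity
    have e1 : ((N + 1).choose (c + 1) : ℝ) * ((c + 1) / (N + 1)) = N.choose c := by
      rw [← mul_div_assoc, ← hch2, mul_div_cancel_left₀ _ hpos2]
    have e2 : ((N + 1).choose (c + 1) : ℝ) = N.choose c + N.choose (c + 1) := by
      exact_mod_cast Nat.choose_succ_succ _ _
    push_cast
    rw [mul_add _ _ (averagedMisses _ _ _ _), e1, e2, ← mul_assoc ((c : ℝ) + 1),
      mul_comm ((c : ℝ) + 1), hch]
    field_simp
    ring

lemma isAverage (k : ℕ) (hk : 1 ≤ k) (l : List Z) : IsAverage k l := by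
  induction l with
  | nil => intro M S _ _; simp [markerExp, averagedMisses]
  | cons z l ih =>
    intro M S hS hM
    rw [averagedMisses]
    by_cases hzM : z ∈ M
    · rw [if_pos hzM, ← ih M S hS hM]
      refine Finset.sum_congr rfl fun D hD => ?_
      have := @(Finset.mem_powersetCard.1 hD).1 z
      rw [markerExp, if_pos (by grind), Finset.insert_eq_of_mem hzM]
    rw [if_neg hzM]
    by_cases hMk : M.card = k
    · have hc : (M \ S).card = (S \ M).card := by
        have h1 := Finset.card_sdiff_add_card_inter M S
        have h2 := Finset.card_sdiff_add_card_inter S M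
        rw [Finset.inter_comm] at h2
        omega
      have hu : (M ∪ S) \ (S \ M) = M := by grind
      have hclear : markerExp k (z :: l) M M = markerExp k (z :: l) M ∅ := by
        simp [markerExp, hzM, hMk]
      have := ih.cons_clean (M := ∅) (S := M) hMk
        (by rw [Finset.card_empty]; exact hk) (by simp) hzM
      simp only [Finset.empty_sdiff, Finset.card_empty, Finset.powersetCard_zero,
        Finset.sum_singleton, Finset.sdiff_empty, Finset.empty_union, Nat.choose_zero_right,
        Nat.cast_one, one_mul, insert_empty_eq] at this
      rw [if_pos hMk, hc, Finset.powersetCard_self, Finset.sum_singleton, hu, hclear, this,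
        Nat.choose_self, Nat.cast_one, one_mul]
    · have hlt : M.card < k := lt_of_le_of_ne hM hMk
      rw [if_neg hMk]
      split_ifs with hzS
      · exact ih.cons_stale hS hlt hzM hzS
      · exact ih.cons_clean hS hlt hzM hzS

lemma markerExp_eq_averagedMisses {k : ℕ} (hk : 1 ≤ k) (l : List Z) {S : Finset Z}
    (hS : S.card = k) : markerExp k l S ∅ = averagedMisses k l ∅ S := by
  simpa using isAverage k hk l ∅ S hS (by simp)

lemma harmonic'_succ (k : ℕ) : harmonic' (k + 1) = harmonic' k + 1 / ((k : ℝ) + 1) :=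
  Finset.sum_range_succ _ _

lemma one_le_harmonic' {k : ℕ} (hk : 1 ≤ k) : 1 ≤ harmonic' k := by
  induction k, hk using Nat.le_induction with
  | base => simp [harmonic']
  | succ k _ ih =>
    rw [harmonic'_succ]
    have : (0 : ℝ) ≤ 1 / ((k : ℝ) + 1) := by positivity
    linarith

lemma averagedMisses_append_le {k c : ℕ} {S : Finset Z} (q : List Z) (p : List Z) :
    ∀ M : Finset Z, (M ∪ p.toFinset).card ≤ k → ((M ∪ p.toFinset) \ S).card ≤ c →
      averagedMisses k (p ++ q) M S ≤
        (((M ∪ p.toFinset) \ S).card - (M \ S).card : ℝ)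
          + c * (harmonic' (S \ M).card - harmonic' (S \ (M ∪ p.toFinset)).card)
          + averagedMisses k q (M ∪ p.toFinset) S := by
  induction p with
  | nil => intro M _ _; simp
  | cons z p ih =>
    intro M hk hc
    have hu : M ∪ (z :: p).toFinset = insert z M ∪ p.toFinset := by
      rw [List.toFinset_cons, Finset.union_insert, Finset.insert_union]
    rw [hu] at hk hc ⊢
    rw [List.cons_append, averagedMisses]
    by_cases hzM : z ∈ M
    · rw [if_pos hzM]
      rw [Finset.insert_eq_of_mem hzM] at hk hc ⊢
      exact ih M hk hc
    have hlt : M.card + 1 ≤ k := by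
      rw [← Finset.card_insert_of_notMem hzM]
      exact (Finset.card_le_card Finset.subset_union_left).trans hk
    have key := ih (insert z M) hk hc
    rw [if_neg hzM, if_neg (by omega)]
    split_ifs with hzS
    · have hN : (S \ M).card = (S \ insert z M).card + 1 := by
        rw [Finset.sdiff_insert, Finset.card_erase_add_one (Finset.mem_sdiff.2 ⟨hzS, hzM⟩)]
      have hle : ((M \ S).card : ℝ) ≤ c := by
        refine Nat.cast_le.2 ((Finset.card_le_card (Finset.sdiff_subset_sdiff ?_ le_rfl)).trans hc)
        exact (Finset.subset_insert _ _).trans Finset.subset_union_left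
      have hdiv : ((M \ S).card : ℝ) / ((S \ insert z M).card + 1) ≤
          c * (1 / ((S \ insert z M).card + 1)) := by
        rw [mul_one_div]
        gcongr
      rw [Finset.insert_sdiff_of_mem _ hzS] at key
      rw [hN, harmonic'_succ]
      push_cast
      linarith
    · have hA : S \ insert z M = S \ M := by
        rw [Finset.sdiff_insert,
          Finset.erase_eq_of_notMem (fun h => hzS (Finset.mem_sdiff.1 h).1)]
      rw [Finset.insert_sdiff_of_notMem _ hzS,
        Finset.card_insert_of_notMem (fun h => hzM (Finset.mem_sdiff.1 h).1), hA] at key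
      push_cast at key
      linarith

lemma averagedMisses_phase_le {k : ℕ} {S : Finset Z} (hS : S.card = k) (p q : List Z)
    (hp : p.toFinset.card ≤ k) :
    averagedMisses k (p ++ q) ∅ S ≤
      (p.toFinset \ S).card * harmonic' k + averagedMisses k q p.toFinset S := by
  have key := averagedMisses_append_le (S := S) q p ∅ (by simpa using hp) le_rfl
  simp only [Finset.empty_union, Finset.empty_sdiff, Finset.card_empty, Nat.cast_zero, sub_zero,
    Finset.sdiff_empty, hS] at key
  have h1 := Finset.card_sdiff_add_card_inter p.toFinset S
  have h2 := Finset.card_sdiff_add_card_inter S p.toFinset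
  rw [Finset.inter_comm] at h2
  rcases Nat.eq_zero_or_pos (p.toFinset \ S).card with h0 | h0
  · simpa [h0] using key
  · have hh := one_le_harmonic' (k := (S \ p.toFinset).card) (by omega)
    have : (0 : ℝ) ≤ (p.toFinset \ S).card := by positivity
    nlinarith

lemma averagedMisses_new_phase {k : ℕ} (hk : 1 ≤ k) {z : Z} {l : List Z} {M S : Finset Z}
    (hM : M.card = k) (hz : z ∉ M) :
    averagedMisses k (z :: l) M S = averagedMisses k (z :: l) ∅ M := by
  have : ¬ 0 = k := by omega
  simp [averagedMisses, hM, hz, this]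

lemma isGreatest_phaseEndPos (k n : ℕ) (σ : ℕ → Z) {s : ℕ} (hs : s ≤ n) :
    IsGreatest {e | e ≤ n ∧ ((Finset.Ico s e).image σ).card ≤ k} (phaseEndPos k n σ s) := by
  have hb : BddAbove {e | e ≤ n ∧ ((Finset.Ico s e).image σ).card ≤ k} := ⟨n, fun _ h => h.1⟩
  exact ⟨Nat.sSup_mem ⟨s, hs, by simp⟩ hb, fun _ h => le_csSup hb h⟩

lemma le_phaseEndPos (k n : ℕ) (σ : ℕ → Z) {s : ℕ} (hs : s ≤ n) : s ≤ phaseEndPos k n σ s :=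
  (isGreatest_phaseEndPos k n σ hs).2 ⟨hs, by simp⟩

lemma lt_phaseEndPos {k n : ℕ} (hk : 1 ≤ k) (σ : ℕ → Z) {s : ℕ} (hs : s < n) :
    s < phaseEndPos k n σ s :=
  (isGreatest_phaseEndPos k n σ hs.le).2 ⟨hs, by simpa using hk⟩

lemma phaseStart_le (k n : ℕ) (σ : ℕ → Z) (r : ℕ) : phaseStart k n σ r ≤ n := by
  induction r with
  | zero => simp [phaseStart]
  | succ r ih => exact (isGreatest_phaseEndPos k n σ ih).1.1

lemma min_le_phaseStart {k : ℕ} (hk : 1 ≤ k) (n : ℕ) (σ : ℕ → Z) (r : ℕ) :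
    min r n ≤ phaseStart k n σ r := by
  induction r with
  | zero => simp
  | succ r ih =>
    have hle := le_phaseEndPos k n σ (phaseStart_le k n σ r)
    rw [phaseStart]
    rcases (phaseStart_le k n σ r).lt_or_eq with h | h
    · have := lt_phaseEndPos hk σ h
      omega
    · omega

/-- A greedy phase that ends before the last request has exactly `k` distinct elements,
and the next request is not among them. -/
lemma phase_maximal {k n : ℕ} {σ : ℕ → Z} {s : ℕ} (hs : s ≤ n) (he : phaseEndPos k n σ s < n) :
    ((Finset.Ico s (phaseEndPos k n σ s)).image σ).card = k ∧
      σ (phaseEndPos k n σ s) ∉ (Finset.Ico s (phaseEndPos k n σ s)).image σ := by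
  have hg := isGreatest_phaseEndPos k n σ hs
  have hle := hg.1.2
  have hse := le_phaseEndPos k n σ hs
  generalize phaseEndPos k n σ s = e at *
  have hlt : k < ((Finset.Ico s (e + 1)).image σ).card := by
    by_contra! h
    exact absurd (hg.2 ⟨he, h⟩) (by omega)
  rw [← Finset.insert_Ico_right_eq_Ico_add_one hse, Finset.image_insert] at hlt
  have hi := Finset.card_insert_le (σ e) ((Finset.Ico s e).image σ)
  refine ⟨by omega, fun h => ?_⟩
  rw [Finset.insert_eq_of_mem h] at hlt
  omega

/-- Cache content at the start of phase `r`. -/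
noncomputable def phaseCache (k n : ℕ) (σ : ℕ → Z) (S0 : Finset Z) : ℕ → Finset Z
  | 0 => S0
  | r + 1 => phaseElems k n σ r

lemma cleanSet_eq (k n : ℕ) (σ : ℕ → Z) (S0 : Finset Z) (r : ℕ) :
    cleanSet k n σ S0 r = phaseElems k n σ r \ phaseCache k n σ S0 r := by
  cases r <;> rfl

lemma card_phaseCache {k n : ℕ} {σ : ℕ → Z} {S0 : Finset Z} (hS0 : S0.card = k) {r : ℕ}
    (hr : phaseStart k n σ r < n) : (phaseCache k n σ S0 r).card = k := by
  cases r with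
  | zero => exact hS0
  | succ r => exact (phase_maximal (phaseStart_le k n σ r) hr).1

lemma averagedMisses_le_phases {k n : ℕ} (hk : 1 ≤ k) {S0 : Finset Z} (hS0 : S0.card = k)
    (σ : ℕ → Z) (r : ℕ) :
    averagedMisses k ((List.range n).map σ) ∅ S0 ≤
      (∑ i ∈ Finset.range r, (cleanSet k n σ S0 i).card : ℕ) * harmonic' k
        + averagedMisses k ((List.Ico (phaseStart k n σ r) n).map σ) ∅
            (phaseCache k n σ S0 r) := by
  induction r with
  | zero => simp [phaseStart, phaseCache, List.Ico.zero_bot]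
  | succ r ih =>
    refine ih.trans ?_
    rw [Finset.sum_range_succ, Nat.cast_add, add_mul, add_assoc, add_le_add_iff_left, cleanSet_eq]
    have hs := phaseStart_le k n σ r
    have he := phaseStart_le k n σ (r + 1)
    have hse : phaseStart k n σ r ≤ phaseStart k n σ (r + 1) := le_phaseEndPos k n σ hs
    rcases hs.lt_or_eq with hlt | heq
    · have hp : ((List.Ico (phaseStart k n σ r) (phaseStart k n σ (r + 1))).map σ).toFinset
          = phaseElems k n σ r := by
        ext x
        simp [phaseElems]
      have key := averagedMisses_phase_le (card_phaseCache hS0 hlt)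
        ((List.Ico (phaseStart k n σ r) (phaseStart k n σ (r + 1))).map σ)
        ((List.Ico (phaseStart k n σ (r + 1)) n).map σ)
        (by rw [hp]; exact (isGreatest_phaseEndPos k n σ hs).1.2)
      rw [← List.map_append, List.Ico.append_consecutive hse he, hp] at key
      refine key.trans_eq ?_
      congr 1
      rcases he.lt_or_eq with hlt' | heq'
      · obtain ⟨hcard, hnew⟩ := phase_maximal hs hlt'
        rw [List.Ico.eq_cons hlt', List.map_cons]
        exact averagedMisses_new_phase hk hcard hnew
      · simp [heq', averagedMisses]
    · have heq' : phaseStart k n σ (r + 1) = n := by omega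
      have hH : 0 ≤ harmonic' k := zero_le_one.trans (one_le_harmonic' hk)
      simp only [heq, heq', List.Ico.self_empty, List.map_nil, averagedMisses, add_zero]
      positivity

end MarkerAnalysis

/-- The expected total number of cache misses incurred by the
randomized Marker algorithm on `σ` (starting from initial cache `S0` with
`|S0| = k`, all elements unmarked) is at most `L · H_k`, where `L` is the total
number of clean elements of the greedy phase partition. -/
theorem marker_expected_misses [DecidableEq Z] (k n : ℕ) (hk : 1 ≤ k)
    (S0 : Finset Z) (hS0 : S0.card = k) (σ : ℕ → Z) :
    markerExp k ((List.range n).map σ) S0 ∅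
      ≤ (totalClean k n σ S0 : ℝ) * harmonic' k := by
  rw [markerExp_eq_averagedMisses hk _ hS0]
  refine (averagedMisses_le_phases hk hS0 σ n).trans_eq ?_
  have hend : phaseStart k n σ n = n :=
    le_antisymm (phaseStart_le k n σ n) (by simpa using min_le_phaseStart hk n σ n)
  rw [hend]
  simp [averagedMisses, totalClean]
end
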